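/- If A ∈ ℝ^{n×n} is a premetric and x ∈ ℝⁿ, then A ⊙ x = x if and only if x lies in the image of A*, i.e. if and only if there exists y ∈ ℝⁿ with x = A* ⊙ y. -/

import Mathlib

namespace TropComm

variable {n : ℕ}

/-- Tropical (min-plus) matrix product: `(A ⊙ B) i j = min_s (A i s + B s j)`. -/
def tropMul [NeZero n] (A B : Fin n → Fin n → ℝ) : Fin n → Fin n → ℝ :=
  fun i j => Finset.univ.inf' Finset.univ_nonempty (fun s => A i s + B s j)

/-- Tropical matrix-vector product: `(A ⊙ x) i = min_j (A i j + x j)`. -/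
def tropMulVec [NeZero n] (A : Fin n → Fin n → ℝ) (x : Fin n → ℝ) : Fin n → ℝ :=
  fun i => Finset.univ.inf' Finset.univ_nonempty (fun j => A i j + x j)

/-- Tropical sum: entrywise minimum. -/
def tropSum (A B : Fin n → Fin n → ℝ) : Fin n → Fin n → ℝ :=
  fun i j => min (A i j) (B i j)

/-- `tropPow A k` is the k-fold tropical product `A^{⊙k}` (with the junk value
`tropPow A 0 = A`; only exponents `k ≥ 1` are ever used). -/
def tropPow [NeZero n] (A : Fin n → Fin n → ℝ) : ℕ → (Fin n → Fin n → ℝ)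
  | 0 => A
  | 1 => A
  | (k + 2) => tropMul A (tropPow A (k + 1))

/-- Kleene star `A* = A ⊕ A^{⊙2} ⊕ ⋯ ⊕ A^{⊙n}`. -/
def kleene [NeZero n] (A : Fin n → Fin n → ℝ) : Fin n → Fin n → ℝ :=
  fun i j => Finset.univ.inf' Finset.univ_nonempty (fun k : Fin n => tropPow A (k.val + 1) i j)

/-- A premetric: zero diagonal, positive off-diagonal entries. -/
def IsPremetric (A : Fin n → Fin n → ℝ) : Prop :=
  (∀ i, A i i = 0) ∧ ∀ i j, i ≠ j → 0 < A i j

/-- A polytrope: a premetric satisfying the triangle inequality. -/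
def IsPolytrope (A : Fin n → Fin n → ℝ) : Prop :=
  IsPremetric A ∧ ∀ i j k, A i j ≤ A i k + A k j


/-- Weight of the walk from `i` to `j` through the list `l` of intermediate vertices. -/
def walkWeight (A : Fin n → Fin n → ℝ) (j : Fin n) : Fin n → List (Fin n) → ℝ
  | i, [] => A i j
  | i, s :: l => A i s + walkWeight A j s l

theorem IsPremetric.nonneg {A : Fin n → Fin n → ℝ} (hA : IsPremetric A) (i j : Fin n) :
    0 ≤ A i j := by
  rcases eq_or_ne i j with rfl | h
  · exact (hA.1 i).ge
  · exact (hA.2 i j h).le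

theorem tropPow_le_walkWeight [NeZero n] (A : Fin n → Fin n → ℝ) (j i : Fin n)
    (l : List (Fin n)) : tropPow A (l.length + 1) i j ≤ walkWeight A j i l := by
  induction l generalizing i with
  | nil => exact le_rfl
  | cons s l ih =>
    exact (Finset.inf'_le _ (Finset.mem_univ s)).trans (add_le_add_right (ih s) (A i s))

theorem exists_walkWeight_eq_tropPow [NeZero n] (A : Fin n → Fin n → ℝ) (j i : Fin n) (k : ℕ) :
    ∃ l : List (Fin n), walkWeight A j i l = tropPow A (k + 1) i j := by
  induction k generalizing i with
  | zero => exact ⟨[], rfl⟩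
  | succ k ih =>
    obtain ⟨s, -, hs⟩ := Finset.exists_mem_eq_inf' Finset.univ_nonempty
      (fun s => A i s + tropPow A (k + 1) s j)
    obtain ⟨l, hl⟩ := ih s
    refine ⟨s :: l, ?_⟩
    rw [walkWeight, hl]
    exact hs.symm

theorem exists_walkWeight_eq_kleene [NeZero n] (A : Fin n → Fin n → ℝ) (j i : Fin n) :
    ∃ l : List (Fin n), walkWeight A j i l = kleene A i j := by
  obtain ⟨k, -, hk⟩ := Finset.exists_mem_eq_inf' Finset.univ_nonempty
    (fun k : Fin n => tropPow A (k.val + 1) i j)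
  obtain ⟨l, hl⟩ := exists_walkWeight_eq_tropPow A j i k
  exact ⟨l, hl.trans hk.symm⟩

theorem IsPremetric.exists_nodup_walkWeight_le_of_mem {A : Fin n → Fin n → ℝ}
    (hA : IsPremetric A) (j : Fin n) {i s : Fin n} {l : List (Fin n)} (hi : i ∈ s :: l)
    (hl : (s :: l).Nodup) :
    ∃ l' : List (Fin n), (i :: l').Nodup ∧ walkWeight A j i l' ≤ walkWeight A j s l := by
  induction l generalizing s with
  | nil =>
    obtain rfl : i = s := by simpa using hi
    exact ⟨[], hl, le_rfl⟩
  | cons t l ih =>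
    rcases List.mem_cons.1 hi with rfl | hi
    · exact ⟨t :: l, hl, le_rfl⟩
    · obtain ⟨l', hl', hw⟩ := ih hi hl.of_cons
      exact ⟨l', hl', hw.trans (le_add_of_nonneg_left (hA.nonneg s t))⟩

theorem IsPremetric.exists_nodup_walkWeight_le {A : Fin n → Fin n → ℝ} (hA : IsPremetric A)
    (j i : Fin n) (l : List (Fin n)) :
    ∃ l' : List (Fin n), (i :: l').Nodup ∧ walkWeight A j i l' ≤ walkWeight A j i l := by
  induction l generalizing i with
  | nil => exact ⟨[], List.nodup_singleton i, le_rfl⟩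
  | cons s l ih =>
    obtain ⟨l', hl', hw⟩ := ih s
    by_cases hi : i ∈ s :: l'
    · obtain ⟨l'', hl'', hw'⟩ := hA.exists_nodup_walkWeight_le_of_mem j hi hl'
      exact ⟨l'', hl'', (hw'.trans hw).trans (le_add_of_nonneg_left (hA.nonneg i s))⟩
    · exact ⟨s :: l', List.nodup_cons.2 ⟨hi, hl'⟩, add_le_add_right hw (A i s)⟩

theorem IsPremetric.kleene_le_walkWeight [NeZero n] {A : Fin n → Fin n → ℝ}
    (hA : IsPremetric A) (j i : Fin n) (l : List (Fin n)) :
    kleene A i j ≤ walkWeight A j i l := by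
  obtain ⟨l', hl', hw⟩ := hA.exists_nodup_walkWeight_le j i l
  have hlen : l'.length < n := by simpa using hl'.length_le_card
  exact ((Finset.inf'_le _ (Finset.mem_univ (⟨l'.length, hlen⟩ : Fin n))).trans
    (tropPow_le_walkWeight A j i l')).trans hw

theorem IsPremetric.kleene_le_add [NeZero n] {A : Fin n → Fin n → ℝ} (hA : IsPremetric A)
    (i s j : Fin n) : kleene A i j ≤ A i s + kleene A s j := by
  obtain ⟨l, hl⟩ := exists_walkWeight_eq_kleene A j s
  rw [← hl]
  exact hA.kleene_le_walkWeight j i (s :: l)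

theorem le_walkWeight_add {A : Fin n → Fin n → ℝ} {x : Fin n → ℝ}
    (hx : ∀ i j, x i ≤ A i j + x j) (j i : Fin n) (l : List (Fin n)) :
    x i ≤ walkWeight A j i l + x j := by
  induction l generalizing i with
  | nil => exact hx i j
  | cons s l ih =>
    rw [walkWeight]
    linarith [hx i s, ih s]

theorem tropMulVec_le [NeZero n] (A : Fin n → Fin n → ℝ) (x : Fin n → ℝ) (i j : Fin n) :
    tropMulVec A x i ≤ A i j + x j :=
  Finset.inf'_le _ (Finset.mem_univ j)

theorem le_tropMulVec [NeZero n] {A : Fin n → Fin n → ℝ} {x : Fin n → ℝ} {i : Fin n} {c : ℝ}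
    (h : ∀ j, c ≤ A i j + x j) : c ≤ tropMulVec A x i :=
  Finset.le_inf' _ _ fun j _ => h j

theorem exists_tropMulVec_eq [NeZero n] (A : Fin n → Fin n → ℝ) (x : Fin n → ℝ) (i : Fin n) :
    ∃ j, tropMulVec A x i = A i j + x j := by
  obtain ⟨j, -, hj⟩ := Finset.exists_mem_eq_inf' Finset.univ_nonempty (fun j => A i j + x j)
  exact ⟨j, hj⟩

/-- If `A` is a premetric and `x ∈ ℝⁿ`, then `A ⊙ x = x` iff
`x` lies in the image of `A*`. -/
theorem stmt8 {n : ℕ} [NeZero n] (A : Fin n → Fin n → ℝ)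
    (hA : IsPremetric A) (x : Fin n → ℝ) :
    tropMulVec A x = x ↔ ∃ y : Fin n → ℝ, x = tropMulVec (kleene A) y := by
  constructor
  · intro h
    have hx : ∀ i j, x i ≤ A i j + x j := fun i j =>
      (congrFun h i).symm.le.trans (tropMulVec_le A x i j)
    refine ⟨x, funext fun i => le_antisymm (le_tropMulVec fun j => ?_) ?_⟩
    · obtain ⟨l, hl⟩ := exists_walkWeight_eq_kleene A j i
      rw [← hl]
      exact le_walkWeight_add hx j i l
    · have hii : kleene A i i ≤ A i i := hA.kleene_le_walkWeight i i []
      linarith [tropMulVec_le (kleene A) x i i, hA.1 i]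
  · rintro ⟨y, rfl⟩
    refine funext fun i => le_antisymm ?_ (le_tropMulVec fun s => ?_)
    · simpa [hA.1 i] using tropMulVec_le A (tropMulVec (kleene A) y) i i
    · obtain ⟨j, hj⟩ := exists_tropMulVec_eq (kleene A) y s
      linarith [tropMulVec_le (kleene A) y i j, hA.kleene_le_add i s j]

end TropComm
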